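/- arXiv:2507.08995 — 5 statements merged into one kernel-verified Lean document; each statement's English description precedes it below -/
import Mathlib

section
/- For every fixed element e ∈ N, the images in the quotient V/R of the vectors ω_B, where B ranges over the 11-element subsets of N containing e, form a ℚ-basis of V/R; consequently dim_ℚ(V/R) = binom(n−1, 10). -/
/-- The ℚ-vector space `V` with basis vectors `ω_B` indexed by the 11-element
subsets `B` of `N`. -/
noncomputable abbrev GKV (N : Type*) := {B : Finset N // B.card = 11} →₀ ℚ

/-- The basis vector `ω_B` of `V`. -/
noncomputable def omegaV {N : Type*} (B : Finset N) (hB : B.card = 11) : GKV N :=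
  Finsupp.single ⟨B, hB⟩ 1

/-- The weight-11 relation vector `r_E = ∑_{i=1}^{12} (-1)^i ω_{E ∖ {e_i}}`, for a
12-element subset `E = {e_1 < ⋯ < e_12}` of `N`; the sign `(-1)^i` is expressed via the
number of elements of `E` that are `≤ e_i`. -/
noncomputable def relV {N : Type*} [LinearOrder N] (E : Finset N) (hE : E.card = 12) :
    GKV N :=
  ∑ e ∈ E.attach,
    ((-1 : ℚ) ^ ((E.filter (fun x => x ≤ e.1)).card)) •
      omegaV (E.erase e.1) (by rw [Finset.card_erase_of_mem e.2, hE])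

/-- The subspace `R ⊆ V` spanned by the relation vectors `r_E` over all 12-element
subsets `E` of `N`. -/
noncomputable def relSpanV (N : Type*) [LinearOrder N] : Submodule ℚ (GKV N) :=
  Submodule.span ℚ {v | ∃ (E : Finset N) (hE : E.card = 12), v = relV E hE}

open Finset in
/-- The sign with which `s.erase a` occurs in the simplicial boundary of `s`. -/
def boundarySign {N : Type*} [LinearOrder N] (s : Finset N) (a : N) : ℚ :=
  (-1) ^ #{x ∈ s | x ≤ a}

/-- The simplicial boundary on the free `ℚ`-module on the finite subsets of `N`. -/
noncomputable def boundary (N : Type*) [LinearOrder N] :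
    (Finset N →₀ ℚ) →ₗ[ℚ] (Finset N →₀ ℚ) :=
  Finsupp.linearCombination ℚ
    fun s => ∑ a ∈ s, boundarySign s a • Finsupp.single (s.erase a) 1

section Boundary

variable {N : Type*} [LinearOrder N]

lemma boundary_single (s : Finset N) :
    boundary N (Finsupp.single s 1) =
      ∑ a ∈ s, boundarySign s a • Finsupp.single (s.erase a) 1 := by
  simp [boundary]

lemma boundarySign_ne_zero (s : Finset N) (a : N) : boundarySign s a ≠ 0 := by
  simp [boundarySign]

lemma boundarySign_erase_of_lt {s : Finset N} {a b : N} (ha : a ∈ s) (h : a < b) :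
    boundarySign (s.erase a) b = -boundarySign s b := by
  have hmem : a ∈ s.filter (· ≤ b) := by simp [ha, h.le]
  rw [boundarySign, boundarySign, Finset.filter_erase, ← Finset.card_erase_add_one hmem, pow_succ]
  ring

lemma boundarySign_erase_of_gt {s : Finset N} {a b : N} (h : b < a) :
    boundarySign (s.erase a) b = boundarySign s b := by
  rw [boundarySign, boundarySign, Finset.filter_erase, Finset.erase_eq_of_notMem (by simp [h])]

lemma boundarySign_mul_erase {s : Finset N} {a b : N} (ha : a ∈ s) (hb : b ∈ s) (h : a ≠ b) :
    boundarySign s a * boundarySign (s.erase a) b =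
      -(boundarySign s b * boundarySign (s.erase b) a) := by
  rcases h.lt_or_gt with h | h
  · rw [boundarySign_erase_of_lt ha h, boundarySign_erase_of_gt h]; ring
  · rw [boundarySign_erase_of_lt hb h, boundarySign_erase_of_gt h]; ring

lemma boundary_boundary_single (s : Finset N) :
    boundary N (boundary N (Finsupp.single s 1)) = 0 := by
  simp only [boundary_single, map_sum, map_smul, Finset.smul_sum, smul_smul]
  rw [Finset.sum_sigma']
  refine Finset.sum_involution (fun p _ => ⟨p.2, p.1⟩) ?_ ?_ ?_ ?_
  · rintro ⟨a, b⟩ h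
    simp only [Finset.mem_sigma, Finset.mem_erase] at h
    rw [boundarySign_mul_erase h.1 h.2.2 h.2.1.symm, Finset.erase_right_comm, ← add_smul]
    simp
  · rintro ⟨a, b⟩ h _ heq
    simp only [Finset.mem_sigma, Finset.mem_erase] at h
    exact h.2.1 (congrArg Sigma.fst heq)
  · rintro ⟨a, b⟩ h
    simp only [Finset.mem_sigma, Finset.mem_erase] at h ⊢
    exact ⟨h.2.2, h.2.1.symm, h.1⟩
  · intros; rfl

lemma boundary_single_apply_erase {e : N} {s t : Finset N} (hs : e ∈ s) (ht : e ∈ t) :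
    boundary N (Finsupp.single s 1) (t.erase e) = if s = t then boundarySign t e else 0 := by
  rw [boundary_single, Finsupp.finsetSum_apply, Finset.sum_eq_single e]
  · have h : s.erase e = t.erase e ↔ s = t :=
      ⟨fun h => by rw [← Finset.insert_erase hs, h, Finset.insert_erase ht], fun h => by rw [h]⟩
    simp only [Finsupp.smul_apply, Finsupp.single_apply, h]
    split_ifs with hst <;> simp [hst]
  · intro b _ hb
    have h : s.erase b ≠ t.erase e := fun h =>
      Finset.notMem_erase e t (h ▸ Finset.mem_erase.2 ⟨hb.symm, hs⟩)
    simp [h]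
  · exact fun h => absurd hs h

lemma linearIndependent_boundary_single (e : N) (p : Finset N → Prop) :
    LinearIndependent ℚ
      fun s : {s : Finset N // p s ∧ e ∈ s} => boundary N (Finsupp.single s.1 1) := by
  rw [linearIndependent_iff']
  intro S g h t ht
  have h' := DFunLike.congr_fun h (t.1.erase e)
  rw [Finsupp.finsetSum_apply, Finset.sum_eq_single t] at h'
  · simpa [boundary_single_apply_erase t.2.2 t.2.2, boundarySign_ne_zero] using h'
  · intro s _ hst
    simp [boundary_single_apply_erase s.2.2 t.2.2, Subtype.coe_ne_coe.2 hst]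
  · exact fun h => absurd ht h

end Boundary

section Relations

variable {N : Type*} [LinearOrder N]

/-- The boundary map restricted to `V`, with values in the free module on all subsets. -/
noncomputable def boundaryV (N : Type*) [LinearOrder N] : GKV N →ₗ[ℚ] (Finset N →₀ ℚ) :=
  boundary N ∘ₗ Finsupp.lmapDomain ℚ ℚ Subtype.val

lemma boundaryV_omegaV (B : Finset N) (hB : B.card = 11) :
    boundaryV N (omegaV B hB) = boundary N (Finsupp.single B 1) := by
  simp [boundaryV, omegaV]

lemma boundaryV_relV (E : Finset N) (hE : E.card = 12) : boundaryV N (relV E hE) = 0 := by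
  rw [← boundary_boundary_single E, boundary_single, relV, ← Finset.sum_attach E]
  simp only [map_sum, map_smul, boundaryV_omegaV, boundarySign]

lemma relSpanV_le_ker_boundaryV : relSpanV N ≤ LinearMap.ker (boundaryV N) := by
  rw [relSpanV, Submodule.span_le]
  rintro _ ⟨E, hE, rfl⟩
  exact boundaryV_relV E hE

lemma linearIndependent_mk_omegaV (e : N) :
    LinearIndependent ℚ (fun B : {B : Finset N // B.card = 11 ∧ e ∈ B} =>
      Submodule.Quotient.mk (p := relSpanV N) (omegaV B.1 B.2.1)) := by
  apply LinearIndependent.of_comp ((relSpanV N).liftQ (boundaryV N) relSpanV_le_ker_boundaryV)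
  have h : ⇑((relSpanV N).liftQ (boundaryV N) relSpanV_le_ker_boundaryV) ∘
      (fun B : {B : Finset N // B.card = 11 ∧ e ∈ B} =>
        Submodule.Quotient.mk (p := relSpanV N) (omegaV B.1 B.2.1)) =
      fun B => boundary N (Finsupp.single B.1 1) :=
    funext fun B => boundaryV_omegaV B.1 B.2.1
  rw [h]
  exact linearIndependent_boundary_single e fun B => B.card = 11

lemma mk_omegaV_mem_span (e : N) (B : Finset N) (hB : B.card = 11) :
    Submodule.Quotient.mk (p := relSpanV N) (omegaV B hB) ∈
      Submodule.span ℚ (Set.range (fun B : {B : Finset N // B.card = 11 ∧ e ∈ B} =>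
        Submodule.Quotient.mk (p := relSpanV N) (omegaV B.1 B.2.1))) := by
  by_cases he : e ∈ B
  · exact Submodule.subset_span ⟨⟨B, hB, he⟩, rfl⟩
  have hE : (insert e B).card = 12 := by rw [Finset.card_insert_of_notMem he, hB]
  have hr : Submodule.Quotient.mk (p := relSpanV N) (relV _ hE) = 0 :=
    (Submodule.Quotient.mk_eq_zero _).2 (Submodule.subset_span ⟨_, hE, rfl⟩)
  rw [relV, ← Submodule.mkQ_apply, map_sum,
    ← Finset.add_sum_erase _ _ (Finset.mem_attach _ ⟨e, Finset.mem_insert_self e B⟩)] at hr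
  simp only [map_smul, Submodule.mkQ_apply, Finset.erase_insert he] at hr
  rw [← Submodule.smul_mem_iff _ (boundarySign_ne_zero (insert e B) e), boundarySign,
    eq_neg_of_add_eq_zero_left hr]
  refine Submodule.neg_mem _ (Submodule.sum_mem _ fun a ha => Submodule.smul_mem _ _ ?_)
  refine Submodule.subset_span ⟨⟨(insert e B).erase a.1, ?_, ?_⟩, rfl⟩
  · rw [Finset.card_erase_of_mem a.2, hE]
  · refine Finset.mem_erase.2 ⟨fun h => ?_, Finset.mem_insert_self e B⟩
    exact (Finset.mem_erase.1 ha).1 (Subtype.ext h.symm)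

lemma span_mk_omegaV (e : N) :
    Submodule.span ℚ (Set.range (fun B : {B : Finset N // B.card = 11 ∧ e ∈ B} =>
      Submodule.Quotient.mk (p := relSpanV N) (omegaV B.1 B.2.1))) = ⊤ := by
  rw [eq_top_iff, ← (relSpanV N).range_mkQ, LinearMap.range_eq_map,
    ← (Finsupp.basisSingleOne (R := ℚ)).span_eq, Submodule.map_span_le]
  rintro _ ⟨B, rfl⟩
  simpa [omegaV] using mk_omegaV_mem_span e B.1 B.2

end Relations

lemma card_finset_card_eq_succ_and_mem {N : Type*} [Fintype N] [DecidableEq N] (e : N) (k : ℕ) :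
    Fintype.card {B : Finset N // B.card = k + 1 ∧ e ∈ B} = (Fintype.card N - 1).choose k := by
  rw [← Finset.card_univ (α := N), ← Finset.card_erase_of_mem (Finset.mem_univ e),
    ← Finset.card_powersetCard, Fintype.card_subtype]
  refine Finset.card_nbij' (fun B => B.erase e) (fun C => insert e C) ?_ ?_ ?_ ?_
  · intro B hB
    simp only [Finset.coe_filter, Finset.mem_univ, true_and, Set.mem_ofPred_eq] at hB
    simp [Finset.mem_powersetCard, Finset.card_erase_of_mem hB.2, hB.1,
      Finset.erase_subset_erase]
  · intro C hC
    obtain ⟨hCe, hC⟩ := Finset.mem_powersetCard.1 hC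
    have : e ∉ C := fun h => Finset.notMem_erase e _ (hCe h)
    simp [Finset.card_insert_of_notMem this, hC]
  · intro B hB
    simp only [Finset.coe_filter, Finset.mem_univ, true_and, Set.mem_ofPred_eq] at hB
    exact Finset.insert_erase hB.2
  · intro C hC
    exact Finset.erase_insert fun h =>
      Finset.notMem_erase e _ ((Finset.mem_powersetCard.1 hC).1 h)


/-- For every fixed `e ∈ N`, the images in `V/R` of the vectors `ω_B`, where `B` ranges
over the 11-element subsets of `N` containing `e`, form a ℚ-basis of `V/R`; consequently
`dim_ℚ (V/R) = (n-1).choose 10`. -/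
theorem omega_images_basis_of_quotient
    {N : Type*} [Fintype N] [LinearOrder N] (hn : 11 ≤ Fintype.card N) (e : N) :
    LinearIndependent ℚ (fun B : {B : Finset N // B.card = 11 ∧ e ∈ B} =>
      Submodule.Quotient.mk (p := relSpanV N) (omegaV B.1 B.2.1)) ∧
    Submodule.span ℚ (Set.range (fun B : {B : Finset N // B.card = 11 ∧ e ∈ B} =>
      Submodule.Quotient.mk (p := relSpanV N) (omegaV B.1 B.2.1))) = ⊤ ∧
    Module.finrank ℚ (GKV N ⧸ relSpanV N) = (Fintype.card N - 1).choose 10 := by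
  refine ⟨linearIndependent_mk_omegaV e, span_mk_omegaV e, ?_⟩
  rw [Module.finrank_eq_card_basis
    (Module.Basis.mk (linearIndependent_mk_omegaV e) (span_mk_omegaV e).ge)]
  exact card_finset_card_eq_succ_and_mem e 10
end

section
/- The subspace R ⊆ V spanned by the relation vectors r_E, over all 12-element subsets E of N, has dimension binom(n−1, 11) over ℚ. -/
/-- The sign `(-1)^i` of the `i`-th smallest element `e` of `E`. -/
def positionSign {N : Type*} [LinearOrder N] (E : Finset N) (e : N) : ℚ :=
  (-1) ^ (E.filter (fun x => x ≤ e)).card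

/-- The simplicial boundary of a finite subset, as a combination of finite subsets. -/
noncomputable def simplexBoundary {N : Type*} [LinearOrder N] (E : Finset N) :
    Finset N →₀ ℚ :=
  ∑ e ∈ E, positionSign E e • Finsupp.single (E.erase e) 1

section SimplexBoundary

variable {N : Type*} [LinearOrder N]

lemma positionSign_ne_zero (E : Finset N) (e : N) : positionSign E e ≠ 0 :=
  pow_ne_zero _ (by norm_num)

lemma positionSign_erase_of_lt {E : Finset N} {e f : N} (h : e < f) :
    positionSign (E.erase f) e = positionSign E e := by
  unfold positionSign
  rw [Finset.filter_erase, Finset.erase_eq_of_notMem (by simp [h])]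

lemma positionSign_erase_of_gt {E : Finset N} {e f : N} (hf : f ∈ E) (h : f < e) :
    positionSign (E.erase f) e = -positionSign E e := by
  unfold positionSign
  have hmem : f ∈ E.filter (fun x => x ≤ e) := by simp [hf, h.le]
  rw [Finset.filter_erase, ← Finset.card_erase_add_one hmem, pow_succ]
  ring

lemma positionSign_mul_swap {E : Finset N} {e f : N} (he : e ∈ E) (hf : f ∈ E)
    (hne : f ≠ e) :
    positionSign E e * positionSign (E.erase e) f =
      -(positionSign E f * positionSign (E.erase f) e) := by
  rcases lt_or_gt_of_ne hne with h | h
  · rw [positionSign_erase_of_lt h, positionSign_erase_of_gt hf h]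
    ring
  · rw [positionSign_erase_of_gt he h, positionSign_erase_of_lt h]
    ring

/-- The boundary of a boundary vanishes. -/
lemma sum_positionSign_smul_simplexBoundary_erase (F : Finset N) :
    ∑ e ∈ F, positionSign F e • simplexBoundary (F.erase e) = 0 := by
  simp only [simplexBoundary, Finset.smul_sum, smul_smul]
  rw [Finset.sum_sigma']
  refine Finset.sum_involution (fun p _ => ⟨p.2, p.1⟩) ?_ ?_ ?_ ?_
  · rintro ⟨e, f⟩ h
    simp only [Finset.mem_sigma, Finset.mem_erase] at h
    rw [positionSign_mul_swap h.1 h.2.2 h.2.1, Finset.erase_right_comm, neg_smul,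
      neg_add_cancel]
  · rintro ⟨e, f⟩ h _ heq
    simp only [Finset.mem_sigma, Finset.mem_erase] at h
    exact h.2.1 (congrArg Sigma.fst heq)
  · rintro ⟨e, f⟩ h
    simp only [Finset.mem_sigma, Finset.mem_erase] at h ⊢
    exact ⟨h.2.2, h.2.1.symm, h.1⟩
  · rintro ⟨e, f⟩ _
    rfl

lemma simplexBoundary_insert_apply {m : N} {B C : Finset N} (hB : m ∉ B) (hC : m ∉ C) :
    simplexBoundary (insert m B) C = if B = C then positionSign (insert m B) m else 0 := by
  rw [simplexBoundary, Finset.sum_insert hB, Finset.erase_insert hB, Finsupp.add_apply,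
    Finsupp.finsetSum_apply, Finset.sum_eq_zero, add_zero]
  · simp [Finsupp.single_apply]
  · intro e he
    have hne : (insert m B).erase e ≠ C := by
      rintro rfl
      exact hC (Finset.mem_erase.2 ⟨fun h => hB (h ▸ he), Finset.mem_insert_self _ _⟩)
    simp [hne]

lemma linearIndependent_simplexBoundary_insert (m : N) :
    LinearIndependent ℚ
      (fun B : {B : Finset N // m ∉ B} => simplexBoundary (insert m B.1)) := by
  rw [linearIndependent_iff']
  intro s g hg C hC
  have h := DFunLike.congr_fun hg C.1
  simp only [Finsupp.finsetSum_apply, Finsupp.smul_apply, Finsupp.zero_apply, smul_eq_mul] at h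
  rw [Finset.sum_eq_single_of_mem C hC] at h
  · rw [simplexBoundary_insert_apply C.2 C.2, if_pos rfl] at h
    exact (mul_eq_zero.1 h).resolve_right (positionSign_ne_zero _ _)
  · intro B _ hne
    rw [simplexBoundary_insert_apply B.2 C.2, if_neg (fun h => hne (Subtype.ext h)), mul_zero]

/-- The boundaries of the `(k + 1)`-subsets are spanned by those of the subsets through `m`. -/
lemma span_simplexBoundary_eq (m : N) (k : ℕ) :
    Submodule.span ℚ (simplexBoundary '' {E : Finset N | E.card = k + 1}) =
      Submodule.span ℚ (Set.range fun B : {B : Finset N // m ∉ B ∧ B.card = k} =>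
        simplexBoundary (insert m B.1)) := by
  apply le_antisymm
  · rw [Submodule.span_le]
    rintro _ ⟨E, hE, rfl⟩
    have through : ∀ F : Finset N, m ∈ F → F.card = k + 1 → simplexBoundary F ∈
        Submodule.span ℚ (Set.range fun B : {B : Finset N // m ∉ B ∧ B.card = k} =>
          simplexBoundary (insert m B.1)) := by
      intro F hm hF
      refine Submodule.subset_span ⟨⟨F.erase m, Finset.notMem_erase _ _, ?_⟩, ?_⟩
      · rw [Finset.card_erase_of_mem hm, hF, Nat.add_sub_cancel]
      · simp only [Finset.insert_erase hm]
    by_cases hm : m ∈ E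
    · exact through E hm hE
    · have h := sum_positionSign_smul_simplexBoundary_erase (insert m E)
      rw [Finset.sum_insert hm, Finset.erase_insert hm] at h
      rw [SetLike.mem_coe,
        ← Submodule.smul_mem_iff _ (positionSign_ne_zero (insert m E) m),
        eq_neg_of_add_eq_zero_left h]
      refine Submodule.neg_mem _ (Submodule.sum_mem _ fun e he => Submodule.smul_mem _ _ ?_)
      apply through
      · exact Finset.mem_erase.2 ⟨fun h => hm (h ▸ he), Finset.mem_insert_self _ _⟩
      · rw [Finset.card_erase_of_mem (Finset.mem_insert_of_mem he),
          Finset.card_insert_of_notMem hm, Nat.add_sub_cancel]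
        exact hE
  · apply Submodule.span_mono
    rintro _ ⟨B, rfl⟩
    refine ⟨insert m B.1, ?_, rfl⟩
    simp [Finset.card_insert_of_notMem B.2.1, B.2.2]

lemma card_subtype_notMem_card_eq [Fintype N] (m : N) (k : ℕ) :
    Fintype.card {B : Finset N // m ∉ B ∧ B.card = k} = (Fintype.card N - 1).choose k := by
  rw [Fintype.card_of_subtype ((Finset.univ.erase m).powersetCard k)]
  · simp
  · intro B
    simp [Finset.mem_powersetCard, Finset.subset_erase]

lemma finrank_span_simplexBoundary [Fintype N] [Nonempty N] (k : ℕ) :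
    Module.finrank ℚ
      (Submodule.span ℚ (simplexBoundary '' {E : Finset N | E.card = k + 1})) =
      (Fintype.card N - 1).choose k := by
  obtain ⟨m⟩ := ‹Nonempty N›
  have hli : LinearIndependent ℚ (fun B : {B : Finset N // m ∉ B ∧ B.card = k} =>
      simplexBoundary (insert m B.1)) :=
    (linearIndependent_simplexBoundary_insert m).comp
      (fun B : {B : Finset N // m ∉ B ∧ B.card = k} => ⟨B.1, B.2.1⟩)
      (fun _ _ h => Subtype.ext (Subtype.mk.inj h))
  rw [span_simplexBoundary_eq m, finrank_span_eq_card hli, card_subtype_notMem_card_eq]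

lemma lmapDomain_relV (E : Finset N) (hE : E.card = 12) :
    Finsupp.lmapDomain ℚ ℚ Subtype.val (relV E hE) = simplexBoundary E := by
  rw [relV, map_sum, simplexBoundary, ← Finset.sum_attach E]
  refine Finset.sum_congr rfl fun e _ => ?_
  rw [map_smul, omegaV, Finsupp.lmapDomain_apply, Finsupp.mapDomain_single, positionSign]

lemma map_lmapDomain_relSpanV :
    (relSpanV N).map (Finsupp.lmapDomain ℚ ℚ Subtype.val) =
      Submodule.span ℚ (simplexBoundary '' {E : Finset N | E.card = 11 + 1}) := by
  rw [relSpanV, Submodule.map_span]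
  congr 1
  ext v
  constructor
  · rintro ⟨_, ⟨E, hE, rfl⟩, rfl⟩
    exact ⟨E, hE, (lmapDomain_relV E hE).symm⟩
  · rintro ⟨E, hE, rfl⟩
    exact ⟨relV E hE, ⟨E, hE, rfl⟩, lmapDomain_relV E hE⟩

end SimplexBoundary

/-- The subspace `R ⊆ V` spanned by the relation vectors `r_E`, over all 12-element
subsets `E` of `N`, has dimension `(n-1).choose 11` over ℚ. -/
theorem finrank_relation_span
    {N : Type*} [Fintype N] [LinearOrder N] (hn : 11 ≤ Fintype.card N) :
    Module.finrank ℚ (relSpanV N) = (Fintype.card N - 1).choose 11 := by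
  have : Nonempty N := Fintype.card_pos_iff.1 (by omega)
  rw [← finrank_span_simplexBoundary 11, ← map_lmapDomain_relSpanV]
  exact (Submodule.equivMapOfInjective (Finsupp.lmapDomain ℚ ℚ Subtype.val)
    (Finsupp.mapDomain_injective Subtype.val_injective) _).finrank_eq
end

section
/- The images in the quotient W/S of the eleven vectors Z_{1j}, for 2 ≤ j ≤ 12, form a ℚ-basis of W/S; in particular dim_ℚ(W/S) = 11. -/
/-- Index type for the basis `Z_{ij}`, `1 ≤ i < j ≤ 12`, of the 66-dimensional space `W`
(encoded with 0-indexed `Fin 12`). -/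
def Widx := {p : Fin 12 × Fin 12 // p.1 < p.2}

/-- The 66-dimensional ℚ-vector space `W` with basis `Z_{ij}`, `1 ≤ i < j ≤ 12`. -/
noncomputable abbrev GKW := Widx →₀ ℚ

/-- The basis vector `Z_{ij}` of `W`. -/
noncomputable def Zgen (i j : Fin 12) (h : i < j) : GKW :=
  Finsupp.single ⟨(i, j), h⟩ 1

/-- The weight-13 relation vector
`s_{ijk} = (-1)^{i+j} Z_{ij} - (-1)^{i+k} Z_{ik} + (-1)^{j+k} Z_{jk}`.
(The signs are unaffected by the 0-indexing of `Fin 12` since they change by `(-1)^2`.) -/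
noncomputable def sgen (i j k : Fin 12) (hij : i < j) (hjk : j < k) : GKW :=
  ((-1 : ℚ) ^ ((i : ℕ) + (j : ℕ))) • Zgen i j hij
    - ((-1 : ℚ) ^ ((i : ℕ) + (k : ℕ))) • Zgen i k (hij.trans hjk)
    + ((-1 : ℚ) ^ ((j : ℕ) + (k : ℕ))) • Zgen j k hjk

/-- The subspace `S ⊆ W` spanned by the relation vectors `s_{ijk}` over all triples
`1 ≤ i < j < k ≤ 12`. -/
noncomputable def Sspan : Submodule ℚ GKW :=
  Submodule.span ℚ {v | ∃ (i j k : Fin 12) (hij : i < j) (hjk : j < k), v = sgen i j k hij hjk}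

/-- The standard basis vector `e_i`, with the convention `e_0 = 0`. -/
noncomputable def vertexVec (i : Fin 12) : {j : Fin 12 // 0 < j} →₀ ℚ :=
  if h : 0 < i then Finsupp.single ⟨i, h⟩ 1 else 0

/-- The signed boundary map `Z_{ij} ↦ (-1)^{i+j} (e_j - e_i)`, with `e_0 = 0`. -/
noncomputable def signedBoundary : GKW →ₗ[ℚ] ({j : Fin 12 // 0 < j} →₀ ℚ) :=
  Finsupp.linearCombination ℚ fun p : Widx =>
    ((-1 : ℚ) ^ ((p.1.1 : ℕ) + (p.1.2 : ℕ))) • (vertexVec p.1.2 - vertexVec p.1.1)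

theorem signedBoundary_Zgen (i j : Fin 12) (h : i < j) :
    signedBoundary (Zgen i j h) =
      ((-1 : ℚ) ^ ((i : ℕ) + (j : ℕ))) • (vertexVec j - vertexVec i) :=
  (Finsupp.linearCombination_single ℚ 1 _).trans (one_smul ℚ _)

theorem neg_one_pow_smul_smul_self {M : Type*} [AddCommGroup M] [Module ℚ M] (n : ℕ) (v : M) :
    ((-1 : ℚ) ^ n) • ((-1 : ℚ) ^ n) • v = v := by
  rw [smul_smul, ← mul_pow]
  simp

theorem Sspan_le_ker_signedBoundary : Sspan ≤ LinearMap.ker signedBoundary := by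
  refine Submodule.span_le.mpr ?_
  rintro _ ⟨i, j, k, hij, hjk, rfl⟩
  simp only [sgen, SetLike.mem_coe, LinearMap.mem_ker, map_add, map_sub, map_smul,
    signedBoundary_Zgen, neg_one_pow_smul_smul_self]
  abel

theorem linearIndependent_mk_Zgen_zero :
    LinearIndependent ℚ (fun j : {j : Fin 12 // 0 < j} =>
      Submodule.Quotient.mk (p := Sspan) (Zgen 0 j.1 j.2)) := by
  refine LinearIndependent.of_comp (Sspan.liftQ signedBoundary Sspan_le_ker_signedBoundary) ?_
  have h := (Finsupp.basisSingleOne (R := ℚ)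
    (ι := {j : Fin 12 // 0 < j})).linearIndependent.units_smul
      (fun j => (-1 : ℚˣ) ^ (j.1 : ℕ))
  convert h using 1
  · funext j
    simp [signedBoundary_Zgen, vertexVec, j.2, Units.smul_def]
  · rfl

theorem mk_Zgen_eq (i j : Fin 12) (hi : 0 < i) (hij : i < j) :
    Submodule.Quotient.mk (p := Sspan) (Zgen i j hij) =
      ((-1 : ℚ) ^ ((i : ℕ) + (j : ℕ))) •
        (((-1 : ℚ) ^ (j : ℕ)) • Submodule.Quotient.mk (p := Sspan) (Zgen 0 j (hi.trans hij)) -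
          ((-1 : ℚ) ^ (i : ℕ)) • Submodule.Quotient.mk (p := Sspan) (Zgen 0 i hi)) := by
  have h : Submodule.Quotient.mk (p := Sspan) (sgen 0 i j hi hij) = 0 :=
    (Submodule.Quotient.mk_eq_zero _).mpr (Submodule.subset_span ⟨0, i, j, hi, hij, rfl⟩)
  simp only [sgen, Submodule.Quotient.mk_add, Submodule.Quotient.mk_sub,
    Submodule.Quotient.mk_smul, Fin.val_zero, zero_add] at h
  rw [← neg_one_pow_smul_smul_self ((i : ℕ) + (j : ℕ))
    (Submodule.Quotient.mk (p := Sspan) (Zgen i j hij)), eq_neg_of_add_eq_zero_right h, neg_sub]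

theorem span_mk_Zgen_zero :
    Submodule.span ℚ (Set.range (fun j : {j : Fin 12 // 0 < j} =>
      Submodule.Quotient.mk (p := Sspan) (Zgen 0 j.1 j.2))) = ⊤ := by
  set T := Submodule.span ℚ (Set.range (fun j : {j : Fin 12 // 0 < j} =>
    Submodule.Quotient.mk (p := Sspan) (Zgen 0 j.1 j.2)))
  have zero_mem (j : Fin 12) (hj : 0 < j) :
      Submodule.Quotient.mk (p := Sspan) (Zgen 0 j hj) ∈ T :=
    Submodule.subset_span ⟨⟨j, hj⟩, rfl⟩
  have gen_mem (i j : Fin 12) (h : i < j) :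
      Submodule.Quotient.mk (p := Sspan) (Zgen i j h) ∈ T := by
    rcases eq_zero_or_pos i with rfl | hi
    · exact zero_mem j h
    · rw [mk_Zgen_eq i j hi h]
      exact T.smul_mem _ (T.sub_mem (T.smul_mem _ (zero_mem _ _)) (T.smul_mem _ (zero_mem _ _)))
  refine Submodule.eq_top_iff'.mpr fun x => ?_
  obtain ⟨w, rfl⟩ := Submodule.Quotient.mk_surjective _ x
  induction w using Finsupp.induction_linear with
  | zero => exact T.zero_mem
  | add f g hf hg => exact T.add_mem hf hg
  | single p c =>
    have hs : (Finsupp.single p c : GKW) = c • Zgen p.1.1 p.1.2 p.2 :=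
      (Finsupp.smul_single_one p c).symm
    rw [hs, Submodule.Quotient.mk_smul]
    exact T.smul_mem _ (gen_mem _ _ _)

/-- The images in `W/S` of the eleven vectors `Z_{1j}`, `2 ≤ j ≤ 12`, form a ℚ-basis of
`W/S`; in particular `dim_ℚ (W/S) = 11`. -/
theorem Z_one_j_basis_of_quotient :
    LinearIndependent ℚ (fun j : {j : Fin 12 // 0 < j} =>
      Submodule.Quotient.mk (p := Sspan) (Zgen 0 j.1 j.2)) ∧
    Submodule.span ℚ (Set.range (fun j : {j : Fin 12 // 0 < j} =>
      Submodule.Quotient.mk (p := Sspan) (Zgen 0 j.1 j.2))) = ⊤ ∧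
    Module.finrank ℚ (GKW ⧸ Sspan) = 11 := by
  refine ⟨linearIndependent_mk_Zgen_zero, span_mk_Zgen_zero, ?_⟩
  rw [Module.finrank_eq_card_basis
    (Module.Basis.mk linearIndependent_mk_Zgen_zero span_mk_Zgen_zero.ge)]
  decide
end

section
/- The subspace S ⊆ W spanned by the relation vectors s_{ijk}, over all triples 1 ≤ i < j < k ≤ 12, has dimension 55 over ℚ. -/
theorem sgen_eq_sub_add (a i j k : Fin 12) (hai : a < i) (hij : i < j) (hjk : j < k) :
    sgen i j k hij hjk = sgen a i j hai hij - sgen a i k hai (hij.trans hjk)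
      + sgen a j k (hai.trans hij) hjk := by
  unfold sgen
  abel

/-- The relation vectors `s_{0jk}` with `0 < j < k`, which form a basis of `S`. -/
noncomputable def sgenZero (p : {p : Fin 11 × Fin 11 // p.1 < p.2}) : GKW :=
  sgen 0 p.1.1.succ p.1.2.succ (Fin.succ_pos _) (Fin.succ_lt_succ_iff.mpr p.2)

/-- The pair `(j, k)` with `0 < j < k` obtained by shifting a pair of `Fin 11` by one. -/
def succPair (p : {p : Fin 11 × Fin 11 // p.1 < p.2}) : Widx :=
  ⟨(p.1.1.succ, p.1.2.succ), Fin.succ_lt_succ_iff.mpr p.2⟩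

theorem Zgen_apply (i j : Fin 12) (h : i < j) (x : Widx) :
    Zgen i j h x = if (i, j) = x.1 then 1 else 0 := by
  classical
  exact Finsupp.single_apply.trans (if_congr Subtype.ext_iff rfl rfl)

theorem sgenZero_apply_succPair (p q : {p : Fin 11 × Fin 11 // p.1 < p.2}) :
    sgenZero p (succPair q) =
      if p = q then (-1 : ℚ) ^ ((p.1.1.succ : ℕ) + (p.1.2.succ : ℕ)) else 0 := by
  obtain ⟨⟨a, b⟩, hp⟩ := p
  obtain ⟨⟨c, d⟩, hq⟩ := q
  rw [sgenZero, sgen, Finsupp.add_apply, Finsupp.sub_apply, Finsupp.smul_apply,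
    Finsupp.smul_apply, Finsupp.smul_apply, Zgen_apply, Zgen_apply, Zgen_apply]
  simp [succPair, (Fin.succ_ne_zero _).symm]

theorem linearIndependent_sgenZero : LinearIndependent ℚ sgenZero := by
  rw [linearIndependent_iff']
  intro s g hg q hq
  have h := DFunLike.congr_fun hg (succPair q)
  rw [Finsupp.finsetSum_apply, Finset.sum_eq_single_of_mem q hq] at h
  · rw [Finsupp.smul_apply, sgenZero_apply_succPair, if_pos rfl] at h
    exact (mul_eq_zero.mp h).resolve_right (pow_ne_zero _ (neg_ne_zero.mpr one_ne_zero))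
  · intro p _ hpq
    rw [Finsupp.smul_apply, sgenZero_apply_succPair, if_neg hpq, smul_zero]

theorem span_range_sgenZero : Submodule.span ℚ (Set.range sgenZero) = Sspan := by
  have mem_of_pos (j k : Fin 12) (hj : 0 < j) (hjk : j < k) :
      sgen 0 j k hj hjk ∈ Submodule.span ℚ (Set.range sgenZero) := by
    obtain ⟨a, rfl⟩ := Fin.exists_succ_eq.mpr hj.ne'
    obtain ⟨b, rfl⟩ := Fin.exists_succ_eq.mpr (hj.trans hjk).ne'
    exact Submodule.subset_span ⟨⟨(a, b), Fin.succ_lt_succ_iff.mp hjk⟩, rfl⟩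
  apply le_antisymm
  · apply Submodule.span_mono
    rintro _ ⟨p, rfl⟩
    exact ⟨_, _, _, _, _, rfl⟩
  · refine Submodule.span_le.mpr ?_
    rintro _ ⟨i, j, k, hij, hjk, rfl⟩
    rcases (Fin.zero_le i).eq_or_lt with rfl | hi
    · exact mem_of_pos j k hij hjk
    · rw [sgen_eq_sub_add 0 i j k hi hij hjk]
      exact add_mem (sub_mem (mem_of_pos _ _ _ _) (mem_of_pos _ _ _ _)) (mem_of_pos _ _ _ _)

/-- The subspace `S ⊆ W` spanned by the relation vectors `s_{ijk}`, over all triples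
`1 ≤ i < j < k ≤ 12`, has dimension 55 over ℚ. -/
theorem finrank_Sspan : Module.finrank ℚ Sspan = 55 := by
  rw [← span_range_sgenZero, finrank_span_eq_card linearIndependent_sgenZero]
  rfl
end

section
/- The subspace of U spanned by the elements r^{(1)}_{i,{x,y}}, over all i ∈ N and all 2-element subsets {x,y} ⊆ N∖{i}, equals the subspace of U spanned by the elements r^{(2)}_{i,j}, over all 2-element subsets {i,j} ⊆ N; that is, the two families of relations generate the same subspace of relations. -/
/-- Index type for the unordered partitions `N = A ⊔ A'` with `|A|, |A'| ≥ 2`, encoded as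
the two-element set `{A, Aᶜ}` of subsets of `N`. -/
def PartIdx (N : Type*) [Fintype N] [DecidableEq N] :=
  {P : Finset (Finset N) // ∃ A : Finset N, 2 ≤ A.card ∧ 2 ≤ Aᶜ.card ∧ P = {A, Aᶜ}}

/-- Index type for the basis of `U`: the `ψ_i` for `i ∈ N`, and the `δ_{{A,A'}}` for the
unordered partitions `N = A ⊔ A'` with `|A|, |A'| ≥ 2`. -/
def Uidx (N : Type*) [Fintype N] [DecidableEq N] := N ⊕ PartIdx N

/-- The ℚ-vector space `U` with basis vectors `ψ_i` and `δ_{{A,A'}}`. -/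
noncomputable abbrev GKU (N : Type*) [Fintype N] [DecidableEq N] := Uidx N →₀ ℚ

/-- The basis vector `ψ_i` of `U`. -/
noncomputable def psiU {N : Type*} [Fintype N] [DecidableEq N] (i : N) : GKU N :=
  Finsupp.single (Sum.inl i) 1

/-- The basis vector `δ_{{A, Aᶜ}}` of `U`, extended by `0` when the cardinality
constraints fail. -/
noncomputable def deltaU {N : Type*} [Fintype N] [DecidableEq N] (A : Finset N) : GKU N :=
  if h : 2 ≤ A.card ∧ 2 ≤ Aᶜ.card then
    Finsupp.single (Sum.inr ⟨{A, Aᶜ}, A, h.1, h.2, rfl⟩) 1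
  else 0

/-- The relation vector `r^{(1)}_{i,{x,y}} = ψ_i − Σ δ_{{A,A'}}`, the sum over all
partitions `A ⊔ A' = N` with `|A|, |A'| ≥ 2`, `i ∈ A` and `x, y ∈ A'`. -/
noncomputable def rel1U {N : Type*} [Fintype N] [DecidableEq N] (i x y : N) : GKU N :=
  psiU i - ∑ A ∈ Finset.univ.filter
      (fun A : Finset N => i ∈ A ∧ x ∈ Aᶜ ∧ y ∈ Aᶜ ∧ 2 ≤ A.card ∧ 2 ≤ Aᶜ.card),
    deltaU A

/-- The relation vector `r^{(2)}_{i,j} = ψ_i + ψ_j − Σ δ_{{A,A'}}`, the sum over all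
partitions `A ⊔ A' = N` with `|A|, |A'| ≥ 2`, `i ∈ A` and `j ∈ A'`. -/
noncomputable def rel2U {N : Type*} [Fintype N] [DecidableEq N] (i j : N) : GKU N :=
  psiU i + psiU j - ∑ A ∈ Finset.univ.filter
      (fun A : Finset N => i ∈ A ∧ j ∈ Aᶜ ∧ 2 ≤ A.card ∧ 2 ≤ Aᶜ.card),
    deltaU A

theorem deltaU_compl {N : Type*} [Fintype N] [DecidableEq N] (A : Finset N) :
    deltaU Aᶜ = deltaU A := by
  unfold deltaU
  by_cases h : 2 ≤ A.card ∧ 2 ≤ Aᶜ.card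
  · have h' : 2 ≤ Aᶜ.card ∧ 2 ≤ Aᶜᶜ.card := by simpa only [compl_compl] using h.symm
    rw [dif_pos h, dif_pos h']
    congr 3
    simp only [compl_compl, Finset.pair_comm]
  · have h' : ¬ (2 ≤ Aᶜ.card ∧ 2 ≤ Aᶜᶜ.card) := by
      rwa [compl_compl, and_comm]
    rw [dif_neg h, dif_neg h']

theorem rel1U_comm {N : Type*} [Fintype N] [DecidableEq N] (i x y : N) :
    rel1U i x y = rel1U i y x := by
  unfold rel1U
  congr 2
  ext A
  simp only [Finset.mem_filter]
  tauto

/-- Splitting the partitions that separate `i` from `j` by the side containing `x`. -/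
theorem rel2U_eq_rel1U_add_rel1U {N : Type*} [Fintype N] [DecidableEq N] (i j x : N) :
    rel2U i j = rel1U i j x + rel1U j i x := by
  have hcompl : ∑ A ∈ Finset.univ.filter
        (fun A : Finset N => j ∈ A ∧ i ∈ Aᶜ ∧ x ∈ Aᶜ ∧ 2 ≤ A.card ∧ 2 ≤ Aᶜ.card), deltaU A =
      ∑ A ∈ Finset.univ.filter
        (fun A : Finset N => (i ∈ A ∧ j ∈ Aᶜ ∧ 2 ≤ A.card ∧ 2 ≤ Aᶜ.card) ∧ ¬ x ∈ Aᶜ),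
        deltaU A := by
    refine Finset.sum_nbij' compl compl ?_ ?_ ?_ ?_ ?_
    · intro A
      simp only [Finset.mem_filter, Finset.mem_univ, compl_compl, Finset.mem_compl]
      tauto
    · intro A
      simp only [Finset.mem_filter, Finset.mem_univ, compl_compl, Finset.mem_compl]
      tauto
    · exact fun A _ => compl_compl A
    · exact fun A _ => compl_compl A
    · exact fun A _ => (deltaU_compl A).symm
  have hsplit : Finset.univ.filter
        (fun A : Finset N => i ∈ A ∧ j ∈ Aᶜ ∧ x ∈ Aᶜ ∧ 2 ≤ A.card ∧ 2 ≤ Aᶜ.card) =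
      Finset.univ.filter
        (fun A : Finset N => (i ∈ A ∧ j ∈ Aᶜ ∧ 2 ≤ A.card ∧ 2 ≤ Aᶜ.card) ∧ x ∈ Aᶜ) := by
    ext A
    simp only [Finset.mem_filter]
    tauto
  unfold rel2U rel1U
  rw [hcompl, hsplit, ← Finset.sum_filter_add_sum_filter_not _ (fun A : Finset N => x ∈ Aᶜ),
    Finset.filter_filter, Finset.filter_filter]
  abel

theorem rel1U_eq_half_smul {N : Type*} [Fintype N] [DecidableEq N] (i x y : N) :
    rel1U i x y = (1 / 2 : ℚ) • (rel2U i x + rel2U i y - rel2U x y) := by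
  rw [rel2U_eq_rel1U_add_rel1U i x y, rel2U_eq_rel1U_add_rel1U i y x,
    rel2U_eq_rel1U_add_rel1U x y i, rel1U_comm i y x, rel1U_comm x y i, rel1U_comm y x i]
  module

/-- The subspace of `U` spanned by the relations `r^{(1)}_{i,{x,y}}`, over all `i ∈ N` and
2-element subsets `{x,y} ⊆ N ∖ {i}`, equals the subspace spanned by the relations
`r^{(2)}_{i,j}`, over all 2-element subsets `{i,j} ⊆ N`: the two families of relations
generate the same subspace of relations. -/
theorem rel1_span_eq_rel2_span {N : Type*} [Fintype N] [DecidableEq N]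
    (hn : 4 ≤ Fintype.card N) :
    Submodule.span ℚ {v : GKU N | ∃ i x y : N, i ≠ x ∧ i ≠ y ∧ x ≠ y ∧ v = rel1U i x y} =
    Submodule.span ℚ {v : GKU N | ∃ i j : N, i ≠ j ∧ v = rel2U i j} := by
  apply le_antisymm <;> rw [Submodule.span_le]
  · rintro _ ⟨i, x, y, hix, hiy, hxy, rfl⟩
    rw [rel1U_eq_half_smul]
    exact Submodule.smul_mem _ _ (Submodule.sub_mem _ (Submodule.add_mem _
      (Submodule.subset_span ⟨i, x, hix, rfl⟩) (Submodule.subset_span ⟨i, y, hiy, rfl⟩))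
      (Submodule.subset_span ⟨x, y, hxy, rfl⟩))
  · rintro _ ⟨i, j, hij, rfl⟩
    obtain ⟨x, hx⟩ : ∃ x, x ∉ ({i, j} : Finset N) := by
      by_contra! h
      have hcard : Fintype.card N ≤ ({i, j} : Finset N).card :=
        Finset.card_le_card fun x _ => h x
      have := Finset.card_le_two (a := i) (b := j)
      omega
    simp only [Finset.mem_insert, Finset.mem_singleton, not_or] at hx
    rw [rel2U_eq_rel1U_add_rel1U i j x]
    exact Submodule.add_mem _
      (Submodule.subset_span ⟨i, j, x, hij, Ne.symm hx.1, Ne.symm hx.2, rfl⟩)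
      (Submodule.subset_span ⟨j, i, x, hij.symm, Ne.symm hx.2, Ne.symm hx.1, rfl⟩)
end
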